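/- Suppose V is C-convex on Ω and let (z_k) be a sequence generated by the improved conditional gradient algorithm with the Armijo step rule. Then every cluster point ẑ of (z_k) is a weakly efficient solution of the problem of minimizing V over Ω: there is no z ∈ Ω with V(z) − V(ẑ) ∈ −int C. -/

import Mathlib

open Metric Set

/-- The oriented distance function associated with the cone `C`:
`φ_C(y) = d(y, -C) - d(y, ℝ^m \\ (-C))`. -/
noncomputable def phiC {m : ℕ} (C : Set (EuclideanSpace ℝ (Fin m)))
    (y : EuclideanSpace ℝ (Fin m)) : ℝ :=
  Metric.infDist y (-C) - Metric.infDist y ((-C)ᶜ)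

/-- The optimal value `θ(z) = min_{s ∈ Ω} φ_C (JV(z)(s - z))`. -/
noncomputable def theta {m n : ℕ} (C : Set (EuclideanSpace ℝ (Fin m)))
    (Ω : Set (EuclideanSpace ℝ (Fin n)))
    (V : EuclideanSpace ℝ (Fin n) → EuclideanSpace ℝ (Fin m))
    (z : EuclideanSpace ℝ (Fin n)) : ℝ :=
  sInf ((fun s => phiC C (fderiv ℝ V z (s - z))) '' Ω)

open Filter Topology

section Cone

open scoped Pointwise

variable {E : Type*} [NormedAddCommGroup E] [NormedSpace ℝ E] {C : Set E}

theorem add_mem_of_convex_cone (hconv : Convex ℝ C)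
    (hcone : ∀ a ∈ C, ∀ l : ℝ, 0 ≤ l → l • a ∈ C) {a b : E} (ha : a ∈ C) (hb : b ∈ C) :
    a + b ∈ C := by
  have h := hcone _ (hconv ha hb (by norm_num : (0 : ℝ) ≤ 1 / 2)
    (by norm_num : (0 : ℝ) ≤ 1 / 2) (by norm_num)) 2 (by norm_num)
  rw [smul_add, smul_smul, smul_smul] at h
  norm_num at h
  exact h

theorem add_mem_interior_of_convex_cone (hconv : Convex ℝ C)
    (hcone : ∀ a ∈ C, ∀ l : ℝ, 0 ≤ l → l • a ∈ C) {a b : E} (ha : a ∈ interior C) (hb : b ∈ C) :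
    a + b ∈ interior C := by
  refine interior_mono ?_ (subset_interior_add_left (Set.add_mem_add ha hb))
  rintro _ ⟨x, hx, y, hy, rfl⟩
  exact add_mem_of_convex_cone hconv hcone hx hy

theorem smul_mem_interior_of_cone (hcone : ∀ a ∈ C, ∀ l : ℝ, 0 ≤ l → l • a ∈ C) {a : E}
    (ha : a ∈ interior C) {l : ℝ} (hl : 0 < l) : l • a ∈ interior C := by
  have h : l • a ∈ interior (l • C) := by
    rw [interior_smul₀ hl.ne']
    exact Set.smul_mem_smul_set ha
  refine interior_mono ?_ h
  rintro _ ⟨x, hx, rfl⟩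
  exact hcone x hx l hl.le

theorem eq_univ_of_zero_mem_interior_cone (hcone : ∀ a ∈ C, ∀ l : ℝ, 0 ≤ l → l • a ∈ C)
    (h0 : (0 : E) ∈ interior C) : C = Set.univ := by
  refine Set.eq_univ_of_forall fun x => ?_
  have hlim : Tendsto (fun l : ℝ => l • x) (𝓝[>] 0) (𝓝 0) := by
    have h : Tendsto (fun l : ℝ => l • x) (𝓝 0) (𝓝 ((0 : ℝ) • x)) :=
      tendsto_id.smul_const x
    rw [zero_smul] at h
    exact h.mono_left nhdsWithin_le_nhds
  obtain ⟨l, hl, hpos⟩ :=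
    ((hlim.eventually (mem_interior_iff_mem_nhds.mp h0)).and self_mem_nhdsWithin).exists
  have hpos : 0 < l := hpos
  have h := hcone _ hl l⁻¹ (inv_nonneg.mpr hpos.le)
  rwa [inv_smul_smul₀ hpos.ne'] at h

/-- The gradient inequality for cone-convex maps. -/
theorem sub_sub_fderiv_mem_of_coneConvex {F : Type*} [NormedAddCommGroup F] [NormedSpace ℝ F]
    {Ω : Set F} {V : F → E} (hclosed : IsClosed C)
    (hcone : ∀ a ∈ C, ∀ l : ℝ, 0 ≤ l → l • a ∈ C)
    (hCconv : ∀ x ∈ Ω, ∀ y ∈ Ω, ∀ t ∈ Set.Icc (0 : ℝ) 1,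
      t • V x + (1 - t) • V y - V (t • x + (1 - t) • y) ∈ C)
    {x y : F} (hx : x ∈ Ω) (hy : y ∈ Ω) (hV : DifferentiableAt ℝ V y) :
    V x - V y - fderiv ℝ V y (x - y) ∈ C := by
  have hlim := (hV.hasFDerivAt.hasLineDerivAt (x - y)).tendsto_slope_zero_right
  refine hclosed.mem_of_tendsto (hlim.const_sub (V x - V y)) ?_
  filter_upwards [Ioo_mem_nhdsGT (zero_lt_one' ℝ)] with t ht
  have h := hcone _ (hCconv x hx y hy t ⟨ht.1.le, ht.2.le⟩) t⁻¹ (inv_nonneg.mpr ht.1.le)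
  convert h using 1
  have hpt : t • x + (1 - t) • y = y + t • (x - y) := by module
  rw [hpt, show t • V x + (1 - t) • V y - V (y + t • (x - y))
    = t • (V x - V y) - (V (y + t • (x - y)) - V y) by module, smul_sub t⁻¹ (t • _),
    inv_smul_smul₀ ht.1.ne']

end Cone

/-- Difference quotients with moving base point, direction and vanishing step. -/
theorem HasStrictFDerivAt.tendsto_inv_smul_sub {E F ι : Type*} [NormedAddCommGroup E]
    [NormedSpace ℝ E] [NormedAddCommGroup F] [NormedSpace ℝ F] {V : F → E} {V' : F →L[ℝ] E}
    {l : Filter ι} {x d : ι → F} {r : ι → ℝ} {x₀ d₀ : F} (hV : HasStrictFDerivAt V V' x₀)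
    (hx : Tendsto x l (𝓝 x₀)) (hd : Tendsto d l (𝓝 d₀)) (hr : Tendsto r l (𝓝 0))
    (hr0 : ∀ᶠ i in l, r i ≠ 0) :
    Tendsto (fun i => (r i)⁻¹ • (V (x i + r i • d i) - V (x i))) l (𝓝 (V' d₀)) := by
  have hpt : Tendsto (fun i => (x i + r i • d i, x i)) l (𝓝 (x₀, x₀)) := by
    refine Tendsto.prodMk_nhds ?_ hx
    simpa using hx.add (hr.smul hd)
  have ho := hV.isLittleO.comp_tendsto hpt
  have hO : (fun i => (r i)⁻¹ • (V (x i + r i • d i) - V (x i) - V' (r i • d i)))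
      =o[l] fun i => (r i)⁻¹ • (r i • d i) := by
    refine (Asymptotics.isBigO_refl (fun i => (r i)⁻¹) l).smul_isLittleO ?_
    simpa [Function.comp_def] using ho
  have hO' : (fun i => (r i)⁻¹ • (V (x i + r i • d i) - V (x i) - V' (r i • d i)))
      =o[l] fun _ => (1 : ℝ) := by
    refine hO.trans_isBigO ((hd.isBigO_one ℝ).congr' ?_ EventuallyEq.rfl)
    filter_upwards [hr0] with i hi
    rw [inv_smul_smul₀ hi]
  have h0 := (Asymptotics.isLittleO_one_iff ℝ).mp hO'
  have hsum := h0.add ((V'.continuous.tendsto d₀).comp hd)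
  rw [zero_add] at hsum
  refine hsum.congr' ?_
  filter_upwards [hr0] with i hi
  simp only [Function.comp_apply, map_smul, smul_sub, inv_smul_smul₀ hi]
  abel

section OrientedDistance

variable {m : ℕ} {C : Set (EuclideanSpace ℝ (Fin m))}

theorem continuous_phiC : Continuous (phiC C) :=
  (continuous_infDist_pt _).sub (continuous_infDist_pt _)

theorem phiC_univ (y : EuclideanSpace ℝ (Fin m)) : phiC Set.univ y = 0 := by
  simp [phiC, infDist_zero_of_mem]

theorem neg_mem_interior_of_phiC_neg {y : EuclideanSpace ℝ (Fin m)} (h : phiC C y < 0) :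
    -y ∈ interior C := by
  have hy : y ∉ closure (-C)ᶜ := fun hy => by
    have h0 := infDist_zero_of_mem_closure hy
    have : 0 ≤ infDist y (-C) := infDist_nonneg
    rw [phiC] at h
    linarith
  rw [closure_compl, Set.notMem_compl_iff, mem_interior_iff_mem_nhds] at hy
  rw [mem_interior_iff_mem_nhds]
  have h2 := (continuous_neg.tendsto (-y)).eventually (by rwa [neg_neg] : ∀ᶠ u in 𝓝 (- -y), u ∈ -C)
  filter_upwards [h2] with u hu
  simpa using hu

theorem phiC_neg_of_neg_mem_interior (hC : C ≠ Set.univ) {y : EuclideanSpace ℝ (Fin m)}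
    (hy : -y ∈ interior C) : phiC C y < 0 := by
  have hne : ((-C)ᶜ).Nonempty := by
    obtain ⟨x, hx⟩ := (Set.ne_univ_iff_exists_notMem C).mp hC
    exact ⟨-x, by simpa using hx⟩
  have hmem : y ∉ closure (-C)ᶜ := by
    rw [closure_compl, Set.notMem_compl_iff, mem_interior_iff_mem_nhds]
    exact (continuous_neg.tendsto y).eventually (mem_interior_iff_mem_nhds.mp hy)
  have hpos := (infDist_pos_iff_notMem_closure hne).mp hmem
  have h0 : infDist y (-C) = 0 := infDist_zero_of_mem (by simpa using interior_subset hy)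
  rw [phiC, h0]
  linarith

end OrientedDistance

theorem icgm_cluster_point_weaklyEfficient {m n : ℕ}
    (C : Set (EuclideanSpace ℝ (Fin m)))
    (hclosed : IsClosed C) (hconv : Convex ℝ C)
    (hcone : ∀ a ∈ C, ∀ l : ℝ, 0 ≤ l → l • a ∈ C)
    (hpointed : C ∩ (-C) = {0})
    (hint : (interior C).Nonempty)
    (Ω : Set (EuclideanSpace ℝ (Fin n)))
    (hΩne : Ω.Nonempty) (hΩcpt : IsCompact Ω) (hΩconv : Convex ℝ Ω)
    (V : EuclideanSpace ℝ (Fin n) → EuclideanSpace ℝ (Fin m))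
    (hV : ContDiff ℝ 1 V)
    (hCconv : ∀ x ∈ Ω, ∀ y ∈ Ω, ∀ t ∈ Set.Icc (0:ℝ) 1,
      t • V x + (1 - t) • V y - V (t • x + (1 - t) • y) ∈ C)
    (β δ : ℝ) (hβ : β ∈ Set.Ioo (0:ℝ) 1) (hδ : δ ∈ Set.Ioo (0:ℝ) 1)
    (z s : ℕ → EuclideanSpace ℝ (Fin n)) (t : ℕ → ℝ) (nk : ℕ → ℕ)
    (hz0 : z 0 ∈ Ω)
    (hsΩ : ∀ k, s k ∈ Ω)
    (hsmin : ∀ k, ∀ u ∈ Ω,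
      phiC C (fderiv ℝ V (z k) (s k - z k)) ≤ phiC C (fderiv ℝ V (z k) (u - z k)))
    (hθ : ∀ k, theta C Ω V (z k) < 0)
    (harm : ∀ k,
      V (z k) + (β * δ ^ nk k) • (fderiv ℝ V (z k) (s k - z k))
        - V (z k + (δ ^ nk k) • (s k - z k)) ∈ C)
    (hleast : ∀ k, ∀ j < nk k,
      V (z k) + (β * δ ^ j) • (fderiv ℝ V (z k) (s k - z k))
        - V (z k + (δ ^ j) • (s k - z k)) ∉ C)
    (ht : ∀ k, t k = δ ^ nk k)
    (hrec : ∀ k, z (k + 1) = z k + t k • (s k - z k))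
    (zhat : EuclideanSpace ℝ (Fin n))
    (hcluster : ∃ φ : ℕ → ℕ, StrictMono φ ∧
      Filter.Tendsto (fun j => z (φ j)) Filter.atTop (nhds zhat)) :
    ¬ ∃ w ∈ Ω, V w - V zhat ∈ -(interior C) := by
  rintro ⟨w, hwΩ, hw⟩
  obtain ⟨φ, hφ, hzφ⟩ := hcluster
  have htpos : ∀ k, 0 < t k := fun k => ht k ▸ pow_pos hδ.1 _
  have ht1 : ∀ k, t k ≤ 1 := fun k => ht k ▸ pow_le_one₀ hδ.1.le hδ.2.le
  have hzΩ : ∀ k, z k ∈ Ω := by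
    intro k
    induction k with
    | zero => exact hz0
    | succ k ih =>
      rw [hrec]
      exact hΩconv.add_smul_sub_mem ih (hsΩ k) ⟨(htpos k).le, ht1 k⟩
  have hzhat : zhat ∈ Ω := hΩcpt.isClosed.mem_of_tendsto hzφ (.of_forall fun j => hzΩ _)
  have hneg : ∀ k, phiC C (fderiv ℝ V (z k) (s k - z k)) < 0 := fun k =>
    (le_csInf (hΩne.image _) (by rintro _ ⟨u, hu, rfl⟩; exact hsmin k u hu)).trans_lt (hθ k)
  have hCuniv : C ≠ Set.univ := by
    rintro rfl
    exact (hneg 0).ne (phiC_univ _)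
  have hdiff : Differentiable ℝ V := hV.differentiable one_ne_zero
  have hfd : Continuous (fderiv ℝ V) := hV.continuous_fderiv one_ne_zero
  have hgrad : phiC C (fderiv ℝ V zhat (w - zhat)) < 0 := by
    refine phiC_neg_of_neg_mem_interior hCuniv ?_
    have h := add_mem_interior_of_convex_cone hconv hcone (Set.mem_neg.mp hw)
      (sub_sub_fderiv_mem_of_coneConvex hclosed hcone hCconv hwΩ hzhat (hdiff zhat))
    convert h using 1
    abel
  have hstep : ∀ k, V (z k) + (β * t k) • fderiv ℝ V (z k) (s k - z k) - V (z (k + 1)) ∈ C := by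
    intro k
    rw [hrec, ht]
    exact harm k
  have hdec : ∀ k, V (z k) - V (z (k + 1)) ∈ C := by
    intro k
    have h := add_mem_of_convex_cone hconv hcone (hstep k)
      (hcone _ (interior_subset (neg_mem_interior_of_phiC_neg (hneg k))) (β * t k)
        (mul_nonneg hβ.1.le (htpos k).le))
    convert h using 1
    module
  have hmono : ∀ p q, p ≤ q → V (z p) - V (z q) ∈ C := by
    intro p q hpq
    induction q, hpq using Nat.le_induction with
    | base =>
      rw [sub_self]
      exact (hpointed.ge rfl).1
    | succ q _ ih =>
      convert add_mem_of_convex_cone hconv hcone ih (hdec q) using 1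
      abel
  let U : Ultrafilter ℕ := Ultrafilter.of atTop
  have hU : (U : Filter ℕ) ≤ atTop := Ultrafilter.of_le atTop
  have hzU : Tendsto (fun j => z (φ j)) U (𝓝 zhat) := hzφ.mono_left hU
  obtain ⟨shat, hshat, hsU⟩ : ∃ a ∈ Ω, Tendsto (fun j => s (φ j)) U (𝓝 a) :=
    hΩcpt.ultrafilter_le_nhds (U.map fun j => s (φ j))
      (le_principal_iff.mpr (Eventually.of_forall (f := (U : Filter ℕ)) fun j => hsΩ (φ j)))
  obtain ⟨τ, hτ, htU⟩ : ∃ a ∈ Set.Icc (0 : ℝ) 1, Tendsto (fun j => t (φ j)) U (𝓝 a) :=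
    isCompact_Icc.ultrafilter_le_nhds (U.map fun j => t (φ j))
      (le_principal_iff.mpr (Eventually.of_forall (f := (U : Filter ℕ)) fun j =>
        ⟨(htpos _).le, ht1 _⟩))
  have hdU := hsU.sub hzU
  have hfdU : Tendsto (fun j => fderiv ℝ V (z (φ j))) U (𝓝 (fderiv ℝ V zhat)) :=
    (hfd.tendsto zhat).comp hzU
  have hJU : Tendsto (fun j => fderiv ℝ V (z (φ j)) (s (φ j) - z (φ j))) U
      (𝓝 (fderiv ℝ V zhat (shat - zhat))) :=
    (isBoundedBilinearMap_apply.continuous.tendsto (_, _)).comp (hfdU.prodMk_nhds hdU)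
  have hlim : -(fderiv ℝ V zhat (shat - zhat)) ∈ interior C := by
    refine neg_mem_interior_of_phiC_neg (lt_of_le_of_lt ?_ hgrad)
    exact le_of_tendsto_of_tendsto ((continuous_phiC.tendsto _).comp hJU)
      ((continuous_phiC.tendsto _).comp ((isBoundedBilinearMap_apply.continuous.tendsto (_, _)).comp
        (hfdU.prodMk_nhds (hzU.const_sub w))))
      (.of_forall fun j => hsmin (φ j) w hwΩ)
  rcases hτ.1.eq_or_lt with hτ0 | hτpos
  · rw [← hτ0] at htU
    have hrU : Tendsto (fun j => t (φ j) / δ) U (𝓝 0) := by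
      simpa using htU.div_const δ
    have hr0 : ∀ j, 0 < t (φ j) / δ := fun j => div_pos (htpos _) hδ.1
    have hq := (hV.contDiffAt.hasStrictFDerivAt one_ne_zero).tendsto_inv_smul_sub hzU hdU hrU
      (.of_forall fun j => (hr0 j).ne')
    have hq' := (hJU.const_smul β).sub hq
    have hin : β • fderiv ℝ V zhat (shat - zhat) - fderiv ℝ V zhat (shat - zhat) ∈ interior C := by
      convert smul_mem_interior_of_cone hcone hlim (sub_pos.mpr hβ.2) using 1
      module
    obtain ⟨j, hjC, hjt⟩ := ((hq'.eventually (mem_interior_iff_mem_nhds.mp hin)).and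
      (htU.eventually (gt_mem_nhds one_pos))).exists
    have hnk : nk (φ j) ≠ 0 := fun h => by
      rw [ht, h, pow_zero] at hjt
      exact lt_irrefl _ hjt
    have hprev : t (φ j) / δ = δ ^ (nk (φ j) - 1) := by
      rw [ht, div_eq_iff hδ.1.ne', pow_sub_one_mul hnk]
    refine hleast (φ j) (nk (φ j) - 1) (Nat.sub_one_lt hnk) ?_
    rw [← hprev]
    have h := hcone _ hjC _ (hr0 j).le
    rw [smul_sub, smul_inv_smul₀ (hr0 j).ne'] at h
    convert h using 1
    module
  · have hsucc : Tendsto (fun j => z (φ (j + 1))) U (𝓝 zhat) :=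
      (hzφ.comp (tendsto_add_atTop_nat 1)).mono_left hU
    have hcont := hdiff.continuous.tendsto zhat
    have hmem : V zhat + (β * τ) • fderiv ℝ V zhat (shat - zhat) - V zhat ∈ C := by
      refine hclosed.mem_of_tendsto
        (((hcont.comp hzU).add ((htU.const_mul β).smul hJU)).sub (hcont.comp hsucc))
        (.of_forall fun j => ?_)
      have h := add_mem_of_convex_cone hconv hcone (hstep (φ j))
        (hmono (φ j + 1) (φ (j + 1)) (hφ j.lt_succ_self))
      convert h using 1
      simp only [Function.comp_apply]
      abel
    rw [add_sub_cancel_left] at hmem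
    refine hCuniv (eq_univ_of_zero_mem_interior_cone hcone ?_)
    convert add_mem_interior_of_convex_cone hconv hcone
      (smul_mem_interior_of_cone hcone hlim (mul_pos hβ.1 hτpos)) hmem using 1
    module
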